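/- F₃(√−3/2 + 1/2) = √3·π³/90 − ζ(3)/2, where √−3 denotes i√3. -/

import Mathlib

open scoped Real

/-- `F₃(τ) = Σ_{m≥1} Σ_{n≥1} e^{2πimnτ}/n³`. -/
noncomputable def F₃ (τ : ℂ) : ℂ :=
  ∑' m : ℕ, ∑' n : ℕ,
    Complex.exp (2 * Real.pi * Complex.I * ((m : ℂ) + 1) * ((n : ℂ) + 1) * τ) / ((n : ℂ) + 1) ^ 3

/-- The terms of the lattice sum `Σ_{n,m≥1} 1/(n²(n²τ² − m²))`. -/
noncomputable def latticeTerm (τ : ℂ) (p : ℕ × ℕ) : ℂ :=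
  1 / (((p.1 : ℂ) + 1) ^ 2 * ((((p.1 : ℂ) + 1) * τ) ^ 2 - ((p.2 : ℂ) + 1) ^ 2))

lemma hasSum_one_div_succ_pow {k : ℕ} (hk : 1 < k) :
    HasSum (fun n : ℕ ↦ 1 / ((n : ℂ) + 1) ^ k) (riemannZeta k) := by
  have hs : Summable (fun n : ℕ ↦ 1 / ((n : ℂ) + 1) ^ k) := by
    have := (summable_nat_add_iff 1).mpr (Complex.summable_one_div_nat_cpow (p := k).mpr
      (by simpa using hk))
    simpa using this
  have := zeta_eq_tsum_one_div_nat_add_one_cpow (s := k) (by simpa using hk)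
  simp only [Complex.cpow_natCast] at this
  exact this ▸ hs.hasSum

lemma summable_one_div_succ_pow {k : ℕ} (hk : 1 < k) :
    Summable (fun n : ℕ ↦ 1 / ((n : ℝ) + 1) ^ k) := by
  simpa using (summable_nat_add_iff 1).mpr (Real.summable_one_div_nat_pow.mpr hk)

lemma norm_natCast_add_one (n : ℕ) : ‖(n : ℂ) + 1‖ = n + 1 := by
  exact_mod_cast Complex.norm_natCast (n + 1)

lemma sq_le_norm_sq_sub_sq {τ : ℂ} (hτ : (τ ^ 2).re ≤ 0) (n m : ℕ) :
    ((m : ℝ) + 1) ^ 2 ≤ ‖(((n : ℂ) + 1) * τ) ^ 2 - ((m : ℂ) + 1) ^ 2‖ := by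
  refine le_trans ?_ (Complex.abs_re_le_norm _)
  have h : ((((n : ℂ) + 1) * τ) ^ 2 - ((m : ℂ) + 1) ^ 2).re =
      ((n : ℝ) + 1) ^ 2 * (τ ^ 2).re - ((m : ℝ) + 1) ^ 2 := by
    rw [mul_pow, show ((n : ℂ) + 1) ^ 2 = (((n : ℝ) + 1) ^ 2 : ℝ) by push_cast; rfl,
      show ((m : ℂ) + 1) ^ 2 = (((m : ℝ) + 1) ^ 2 : ℝ) by push_cast; rfl,
      Complex.sub_re, Complex.re_ofReal_mul, Complex.ofReal_re]
  rw [h]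
  refine le_trans ?_ (neg_le_abs _)
  nlinarith [mul_nonneg (sq_nonneg ((n : ℝ) + 1)) (neg_nonneg.mpr hτ)]

lemma sq_sub_sq_ne_zero {τ : ℂ} (hτ : (τ ^ 2).re ≤ 0) (n m : ℕ) :
    (((n : ℂ) + 1) * τ) ^ 2 - ((m : ℂ) + 1) ^ 2 ≠ 0 :=
  norm_pos_iff.mp (lt_of_lt_of_le (by positivity) (sq_le_norm_sq_sub_sq hτ n m))

lemma summable_latticeTerm {τ : ℂ} (hτ : (τ ^ 2).re ≤ 0) : Summable (latticeTerm τ) := by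
  have h := summable_one_div_succ_pow (k := 2) one_lt_two
  refine Summable.of_norm_bounded
    (h.mul_of_nonneg h (fun _ ↦ by positivity) (fun _ ↦ by positivity)) fun p ↦ ?_
  rw [latticeTerm, norm_div, norm_one, norm_mul, norm_pow, norm_natCast_add_one,
    one_div_mul_one_div]
  gcongr
  exact sq_le_norm_sq_sub_sq hτ _ _

/-- Partial fractions exchange the two summation variables, relating `τ` and `-1/τ`. -/
lemma tsum_latticeTerm_add {τ σ : ℂ} (hτσ : τ * σ = -1) (hτ : (τ ^ 2).re ≤ 0)
    (hσ : (σ ^ 2).re ≤ 0) :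
    ∑' p, latticeTerm τ p + ∑' p, latticeTerm σ p = -riemannZeta 2 ^ 2 := by
  have hz : HasSum (fun n : ℕ ↦ 1 / ((n : ℂ) + 1) ^ 2) (riemannZeta 2) := by
    simpa using hasSum_one_div_succ_pow (k := 2) one_lt_two
  have hprod : riemannZeta 2 ^ 2 =
      ∑' p : ℕ × ℕ, 1 / ((p.1 : ℂ) + 1) ^ 2 * (1 / ((p.2 : ℂ) + 1) ^ 2) := by
    rw [pow_two (riemannZeta 2), ← hz.tsum_eq]
    exact tsum_mul_tsum_of_summable_norm hz.summable.norm hz.summable.norm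
  have hswap : Summable fun p : ℕ × ℕ ↦ latticeTerm σ p.swap :=
    (Equiv.prodComm ℕ ℕ).summable_iff.mpr (summable_latticeTerm hσ)
  have hswap' : ∑' p : ℕ × ℕ, latticeTerm σ p.swap = ∑' p, latticeTerm σ p :=
    (Equiv.prodComm ℕ ℕ).tsum_eq (latticeTerm σ)
  rw [← hswap', ← (summable_latticeTerm hτ).tsum_add hswap, hprod, ← tsum_neg]
  refine tsum_congr fun p ↦ ?_
  have h1 := sq_sub_sq_ne_zero hτ p.1 p.2
  have h3 : (p.1 : ℂ) + 1 ≠ 0 := Nat.cast_add_one_ne_zero _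
  have h4 : (p.2 : ℂ) + 1 ≠ 0 := Nat.cast_add_one_ne_zero _
  have h5 : τ ≠ 0 := by rintro rfl; simp at hτσ
  have h6 : (((p.2 : ℂ) + 1) * σ) ^ 2 - ((p.1 : ℂ) + 1) ^ 2 =
      -((((p.1 : ℂ) + 1) * τ) ^ 2 - ((p.2 : ℂ) + 1) ^ 2) / τ ^ 2 := by
    rw [eq_div_iff (pow_ne_zero 2 h5)]
    linear_combination ((p.2 : ℂ) + 1) ^ 2 * (τ * σ - 1) * hτσ
  simp only [latticeTerm, Prod.fst_swap, Prod.snd_swap, h6]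
  generalize hD : (((p.1 : ℂ) + 1) * τ) ^ 2 - ((p.2 : ℂ) + 1) ^ 2 = D at h1
  field_simp
  linear_combination -hD

lemma pi_mul_cot_eq_tsum {z : ℂ} (hz : 0 < z.im) :
    π * Complex.cot (π * z) =
      1 / z + ∑' m : ℕ, 2 * z * (1 / (z ^ 2 - ((m : ℂ) + 1) ^ 2)) := by
  have hz' : z ∈ Complex.integerComplement := UpperHalfPlane.coe_mem_integerComplement ⟨z, hz⟩
  rw [sub_eq_iff_eq_add'.mp (cot_series_rep' hz')]
  congr 1
  refine tsum_congr fun m ↦ ?_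
  refine (cotTerm_identity hz' m).trans ?_
  ring_nf

lemma tsum_exp_pow_succ {z : ℂ} (hz : 0 < z.im) :
    ∑' m : ℕ, Complex.exp (2 * π * Complex.I * z) ^ (m + 1) =
      -1 / 2 + Complex.I / (2 * π) * (π * Complex.cot (π * z)) := by
  have hq : ‖Complex.exp (2 * π * Complex.I * z)‖ < 1 :=
    UpperHalfPlane.norm_exp_two_pi_I_lt_one ⟨z, hz⟩
  have h := pi_mul_cot_pi_q_exp ⟨z, hz⟩
  have h0 := (summable_geometric_of_norm_lt_one hq).tsum_eq_zero_add
  simp only at h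
  rw [h, h0]
  have hpi : (π : ℂ) ≠ 0 := by exact_mod_cast Real.pi_ne_zero
  field_simp
  ring_nf
  simp only [Complex.I_sq]
  ring

lemma F₃_eq_latticeSum {τ : ℂ} (him : 0 < τ.im) (hτ : (τ ^ 2).re ≤ 0) :
    F₃ τ = -riemannZeta 3 / 2 +
      Complex.I / (2 * π) * (riemannZeta 4 / τ + 2 * τ * ∑' p, latticeTerm τ p) := by
  have hq : ‖Complex.exp (2 * π * Complex.I * τ)‖ < 1 :=
    UpperHalfPlane.norm_exp_two_pi_I_lt_one ⟨τ, him⟩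
  have hτ0 : τ ≠ 0 := by rintro rfl; simp at him
  have hsum : Summable (Function.uncurry fun m n : ℕ ↦
      Complex.exp (2 * π * Complex.I * ((m : ℂ) + 1) * ((n : ℂ) + 1) * τ) / ((n : ℂ) + 1) ^ 3) := by
    refine Summable.of_norm_bounded ((summable_geometric_of_lt_one (norm_nonneg _) hq).mul_of_nonneg
      (summable_one_div_succ_pow (k := 3) (by norm_num)) (fun _ ↦ by positivity)
      (fun _ ↦ by positivity)) fun p ↦ ?_
    have he : Complex.exp (2 * π * Complex.I * ((p.1 : ℂ) + 1) * ((p.2 : ℂ) + 1) * τ) =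
        Complex.exp (2 * π * Complex.I * τ) ^ ((p.1 + 1) * (p.2 + 1)) := by
      rw [← Complex.exp_nat_mul]
      push_cast
      ring_nf
    simp only [Function.uncurry]
    rw [he, norm_div, norm_pow, norm_pow, norm_natCast_add_one, ← div_eq_mul_one_div]
    gcongr ?_ / _
    exact pow_le_pow_of_le_one (norm_nonneg _) hq.le (by nlinarith)
  have hL := summable_latticeTerm hτ
  have hterm (n : ℕ) : ∑' m : ℕ, Complex.exp (2 * π * Complex.I * ((m : ℂ) + 1) *
      ((n : ℂ) + 1) * τ) / ((n : ℂ) + 1) ^ 3 = -1 / 2 * (1 / ((n : ℂ) + 1) ^ 3) +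
        (Complex.I / (2 * π) / τ * (1 / ((n : ℂ) + 1) ^ 4) +
          Complex.I / (2 * π) * (2 * τ) * ∑' m : ℕ, latticeTerm τ (n, m)) := by
    have hz : 0 < (((n : ℂ) + 1) * τ).im := by
      rw [show (n : ℂ) + 1 = ((n + 1 : ℝ) : ℂ) by push_cast; rfl, Complex.im_ofReal_mul]
      positivity
    have hn : (n : ℂ) + 1 ≠ 0 := Nat.cast_add_one_ne_zero _
    have h1 := tsum_exp_pow_succ hz
    rw [pi_mul_cot_eq_tsum hz, tsum_mul_left] at h1
    have h2 : ∑' m : ℕ, latticeTerm τ (n, m) = 1 / ((n : ℂ) + 1) ^ 2 *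
        ∑' m : ℕ, 1 / ((((n : ℂ) + 1) * τ) ^ 2 - ((m : ℂ) + 1) ^ 2) := by
      rw [← tsum_mul_left]
      exact tsum_congr fun m ↦ (one_div_mul_one_div _ _).symm
    have h3 (m : ℕ) : Complex.exp (2 * π * Complex.I * ((m : ℂ) + 1) * ((n : ℂ) + 1) * τ) =
        Complex.exp (2 * π * Complex.I * (((n : ℂ) + 1) * τ)) ^ (m + 1) := by
      rw [← Complex.exp_nat_mul]
      push_cast
      ring_nf
    have hpi : (π : ℂ) ≠ 0 := by exact_mod_cast Real.pi_ne_zero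
    rw [tsum_div_const, tsum_congr h3, h1, h2]
    field_simp
  rw [F₃, ← hsum.tsum_comm, tsum_congr hterm]
  have h3 := (hasSum_one_div_succ_pow (k := 3) (by norm_num)).mul_left (-1 / 2)
  have h4 := (hasSum_one_div_succ_pow (k := 4) (by norm_num)).mul_left
    (Complex.I / (2 * π) / τ)
  have h5 := (hL.hasSum.prod_fiberwise fun n ↦ (hL.prod_factor n).hasSum).mul_left
    (Complex.I / (2 * π) * (2 * τ))
  rw [(h3.add (h4.add h5)).tsum_eq]
  push_cast
  ring

lemma F₃_add_half_zeta {τ : ℂ} (him : 0 < τ.im) (hτ : (τ ^ 2).re ≤ 0) :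
    -2 * π * Complex.I * (F₃ τ + riemannZeta 3 / 2) =
      riemannZeta 4 / τ + 2 * τ * ∑' p, latticeTerm τ p := by
  have hpi : (π : ℂ) ≠ 0 := by exact_mod_cast Real.pi_ne_zero
  have h : -2 * π * Complex.I * (Complex.I / (2 * π)) = 1 := by
    field_simp
    simp
  rw [F₃_eq_latticeSum him hτ]
  linear_combination (riemannZeta 4 / τ + 2 * τ * ∑' p, latticeTerm τ p) * h

lemma F₃_sub_one (τ : ℂ) : F₃ (τ - 1) = F₃ τ := by
  refine tsum_congr fun m ↦ tsum_congr fun n ↦ ?_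
  congr 1
  rw [Complex.exp_eq_exp_iff_exists_int]
  refine ⟨-((m + 1) * (n + 1)), ?_⟩
  push_cast
  ring

theorem F₃_value_a :
    F₃ (Real.sqrt 3 * Complex.I / 2 + 1 / 2) =
      ((Real.sqrt 3 * Real.pi ^ 3 / 90 : ℝ) : ℂ) - riemannZeta 3 / 2 := by
  have hs : ((√3 : ℝ) : ℂ) ^ 2 = 3 := by
    exact_mod_cast Real.sq_sqrt (show (0 : ℝ) ≤ 3 by norm_num)
  set s : ℂ := ((√3 : ℝ) : ℂ) with hs_def
  set τ : ℂ := s * Complex.I / 2 + 1 / 2 with hτ_def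
  have hI := Complex.I_sq
  have hτσ : τ * (τ - 1) = -1 := by
    linear_combination (1 / 4 : ℂ) * Complex.I ^ 2 * hs + 3 / 4 * hI
  have hre : τ.re = 1 / 2 := by simp [hτ_def, hs_def]
  have him : τ.im = √3 / 2 := by simp [hτ_def, hs_def]
  have hpos : 0 < τ.im := by rw [him]; positivity
  have hτ2 : (τ ^ 2).re ≤ 0 := by
    rw [show τ ^ 2 = τ - 1 by linear_combination hτσ]
    simp [hre]; norm_num
  have hσ2 : ((τ - 1) ^ 2).re ≤ 0 := by
    rw [show (τ - 1) ^ 2 = -τ by linear_combination hτσ]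
    simp [hre]
  have hτ0 : τ ≠ 0 := by rintro h; simp [h] at hpos
  have hσ0 : τ - 1 ≠ 0 := by rintro h; simp [h] at hτσ
  have hinv : 1 / τ = 1 - τ := by rw [div_eq_iff hτ0]; linear_combination hτσ
  have hinv' : 1 / (τ - 1) = -τ := by rw [div_eq_iff hσ0]; linear_combination hτσ
  have h1 := F₃_add_half_zeta hpos hτ2
  have h2 := F₃_add_half_zeta (τ := τ - 1) (by simpa using hpos) hσ2
  have h3 := tsum_latticeTerm_add hτσ hτ2 hσ2
  rw [div_eq_mul_one_div _ τ, hinv, riemannZeta_four] at h1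
  rw [F₃_sub_one, div_eq_mul_one_div _ (τ - 1), hinv', riemannZeta_four] at h2
  rw [riemannZeta_two] at h3
  generalize ∑' p, latticeTerm τ p = S at h1 h3
  generalize ∑' p, latticeTerm (τ - 1) p = T at h2 h3
  generalize F₃ τ = F at h1 h2 ⊢
  have hs' : 1 - 2 * τ = -s * Complex.I := by rw [hτ_def]; ring
  clear_value τ s
  have hpi : (π : ℂ) ≠ 0 := by exact_mod_cast Real.pi_ne_zero
  have key : -2 * π * Complex.I * (F + riemannZeta 3 / 2) * (1 - 2 * τ) = -(π : ℂ) ^ 4 / 15 := by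
    linear_combination (1 - τ) * h1 - τ * h2 + 2 * h3 +
      (π ^ 4 / 45 - 2 * S - 2 * T) * hτσ
  rw [hs'] at key
  have key' : s * (F + riemannZeta 3 / 2) = π ^ 3 / 30 := by
    refine mul_left_cancel₀ hpi ?_
    linear_combination -key / 2 + π * s * (F + riemannZeta 3 / 2) * hI
  push_cast
  rw [← hs_def]
  linear_combination s / 3 * key' - (F + riemannZeta 3 / 2) / 3 * hs
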